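/- Let 1 ≤ m ≤ n. For every g ∈ Sp(n,1), the set { trace(g·(I_{n−m} ⊕ A)·g⁻¹) : A ∈ Sp(m,1) } is not contained in ℝ, where I_{n−m} ⊕ A denotes the (n+1)×(n+1) block diagonal matrix whose upper-left block is the identity matrix of size n−m and whose lower-right block is A. -/

import Mathlib

open Matrix BigOperators

noncomputable section

abbrev Hq : Type := Quaternion ℝ

def qi : Hq := ⟨0, 1, 0, 0⟩
def qj : Hq := ⟨0, 0, 1, 0⟩
def qk : Hq := ⟨0, 0, 0, 1⟩

/-- A quaternion is real if all its imaginary parts vanish. -/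
def isRealQ (q : Hq) : Prop := q.imI = 0 ∧ q.imJ = 0 ∧ q.imK = 0

/-- The matrix `J_{n,1}` with diagonal `(1,…,1,−1)`. -/
def Jq (n : ℕ) : Matrix (Fin (n+1)) (Fin (n+1)) Hq :=
  Matrix.diagonal fun i => if i = Fin.last n then -1 else 1

/-- `Sp(n,1)` as a set of `(n+1)×(n+1)` quaternionic matrices. -/
def Sp (n : ℕ) : Set (Matrix (Fin (n+1)) (Fin (n+1)) Hq) :=
  {g | gᴴ * Jq n * g = Jq n}

/-- The complex matrix `J_{m,1}`. -/
def Jc (m : ℕ) : Matrix (Fin (m+1)) (Fin (m+1)) ℂ :=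
  Matrix.diagonal fun i => if i = Fin.last m then -1 else 1

/-- `SU(m,1)` as a set of `(m+1)×(m+1)` complex matrices. -/
def SU (m : ℕ) : Set (Matrix (Fin (m+1)) (Fin (m+1)) ℂ) :=
  {A | Aᴴ * Jc m * A = Jc m ∧ A.det = 1}

/-- The ℝ-algebra embedding `ℂ → ℍ`, `a + b√(−1) ↦ a + b i`. -/
def ι (z : ℂ) : Hq := ⟨z.re, z.im, 0, 0⟩


/-- Block diagonal sum of square matrices. -/
def oplus {R : Type*} [Zero R] {p q : ℕ} (A : Matrix (Fin p) (Fin p) R)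
    (B : Matrix (Fin q) (Fin q) R) : Matrix (Fin (p + q)) (Fin (p + q)) R :=
  Matrix.reindex finSumFinEquiv finSumFinEquiv (Matrix.fromBlocks A 0 0 B)

/-- Reindexing a square matrix along an equality of sizes. -/
def castM {R : Type*} {p q : ℕ} (h : p = q) (A : Matrix (Fin p) (Fin p) R) :
    Matrix (Fin q) (Fin q) R :=
  Matrix.reindex (finCongr h) (finCongr h) A

theorem castM_oplus_diagonal {R : Type*} [Zero R] [One R] {p q r : ℕ} (h : p + q = r)
    (v : Fin q → R) :
    castM h (oplus (1 : Matrix (Fin p) (Fin p) R) (Matrix.diagonal v)) =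
      Matrix.diagonal fun i => Sum.elim 1 v (finSumFinEquiv.symm ((finCongr h).symm i)) := by
  rw [oplus, castM, ← Matrix.diagonal_one, Matrix.fromBlocks_diagonal]
  simp only [Matrix.reindex_apply, Matrix.submatrix_diagonal_equiv]
  rfl

/-- The block sum of an identity matrix with `diag(1,…,1,x)` is again `diag(1,…,1,x)`. -/
theorem castM_oplus_diagonal_last {R : Type*} [Zero R] [One R] {p m n : ℕ}
    (h : p + (m + 1) = n + 1) (x : R) :
    castM h (oplus (1 : Matrix (Fin p) (Fin p) R)
      (Matrix.diagonal fun i => if i = Fin.last m then x else 1)) =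
      Matrix.diagonal fun i => if i = Fin.last n then x else 1 := by
  rw [castM_oplus_diagonal]
  congr 1
  funext i
  obtain ⟨j, rfl⟩ := (finCongr h).surjective i
  obtain ⟨j, rfl⟩ := finSumFinEquiv.surjective j
  rcases j with j | j
  · have : (j : ℕ) ≠ n := by omega
    simp [Fin.ext_iff, this]
  · have : p + (j : ℕ) = n ↔ (j : ℕ) = m := by omega
    simp [Fin.ext_iff, this]

theorem Jq_mul_self (n : ℕ) : Jq n * Jq n = 1 := by
  rw [Jq, Matrix.diagonal_mul_diagonal, ← Matrix.diagonal_one]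
  congr 1
  funext i
  split_ifs <;> simp

theorem inverse_eq_of_mem_Sp {n : ℕ} {g : Matrix (Fin (n+1)) (Fin (n+1)) Hq} (hg : g ∈ Sp n) :
    Ring.inverse g = Jq n * gᴴ * Jq n := by
  have hl : Jq n * gᴴ * Jq n * g = 1 := by
    rw [Matrix.mul_assoc, Matrix.mul_assoc, ← Matrix.mul_assoc gᴴ,
      show gᴴ * Jq n * g = Jq n from hg, Jq_mul_self]
  have hr : g * (Jq n * gᴴ * Jq n) = 1 := mul_eq_one_comm.mp hl
  exact Ring.inverse_unit ⟨g, _, hr, hl⟩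

theorem diagonal_last_mem_Sp {m : ℕ} {x : Hq} (hx : star x * x = 1) :
    (Matrix.diagonal fun i => if i = Fin.last m then x else 1) ∈ Sp m := by
  change _ᴴ * _ * _ = _
  rw [Jq, Matrix.diagonal_conjTranspose, Matrix.diagonal_mul_diagonal,
    Matrix.diagonal_mul_diagonal]
  congr 1
  funext i
  by_cases h : i = Fin.last m <;> simp [h, hx]

theorem star_eq_self_of_isRealQ {q : Hq} (h : isRealQ q) : star q = q := by
  obtain ⟨hi, hj, hk⟩ := h
  ext <;> simp [hi, hj, hk]

theorem norm_sq_last_of_mem_Sp {n : ℕ} {g : Matrix (Fin (n+1)) (Fin (n+1)) Hq} (hg : g ∈ Sp n) :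
    ‖g (Fin.last n) (Fin.last n)‖ ^ 2 = 1 + ∑ a : Fin n, ‖g a.castSucc (Fin.last n)‖ ^ 2 := by
  have h : gᴴ * Jq n * g = Jq n := hg
  have h' : ((gᴴ * Jq n * g) (Fin.last n) (Fin.last n)).re =
      (Jq n (Fin.last n) (Fin.last n)).re := by rw [h]
  rw [Jq, Matrix.mul_apply, Fin.sum_univ_castSucc] at h'
  simp only [Matrix.mul_diagonal, Matrix.conjTranspose_apply, Fin.castSucc_ne_last, if_true,
    if_false, mul_one, mul_neg, neg_mul, Quaternion.star_mul_self, Matrix.diagonal_apply_eq,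
    Quaternion.normSq_eq_norm_mul_self, ← Quaternion.coe_neg] at h'
  have hsum : (∑ a : Fin n,
      ((‖g a.castSucc (Fin.last n)‖ * ‖g a.castSucc (Fin.last n)‖ : ℝ) : Hq)).re =
      ∑ a : Fin n, ‖g a.castSucc (Fin.last n)‖ * ‖g a.castSucc (Fin.last n)‖ :=
    map_sum (QuaternionAlgebra.reₗ (-1 : ℝ) 0 (-1)) _ _
  rw [Quaternion.re_add, Quaternion.re_neg, Quaternion.re_one, Quaternion.re_coe] at h'
  simp only [sq]
  linarith

/-- For `x` a purely imaginary quaternion, twice the imaginary part of the trace of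
`g · diag(1,…,1,x) · (J gᴴ J)` only involves the last column of `g`. -/
theorem trace_sub_star_trace {n : ℕ} (g : Matrix (Fin (n+1)) (Fin (n+1)) Hq) {x : Hq}
    (hx : star x = -x) :
    let t := (g * (Matrix.diagonal fun i => if i = Fin.last n then x else 1) *
      (Jq n * gᴴ * Jq n)).trace
    t - star t = (2 : ℝ) • (g (Fin.last n) (Fin.last n) * x * star (g (Fin.last n) (Fin.last n)) -
      ∑ a : Fin n, g a.castSucc (Fin.last n) * x * star (g a.castSucc (Fin.last n))) := by
  intro t
  have ht : t = ∑ a, ∑ b, g a b * (if b = Fin.last n then x else 1) *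
      ((if b = Fin.last n then -1 else 1) * star (g a b) * (if a = Fin.last n then -1 else 1)) := by
    refine Finset.sum_congr rfl fun a _ => ?_
    rw [Matrix.diag_apply, Matrix.mul_apply]
    simp only [Jq, Matrix.mul_diagonal, Matrix.diagonal_mul, Matrix.conjTranspose_apply]
  rw [ht]
  simp only [Fin.sum_univ_castSucc, Fin.castSucc_ne_last, if_true, if_false, mul_one,
    mul_neg, neg_mul, neg_neg, star_add, star_sum, star_neg, star_mul, star_star, hx,
    Finset.sum_add_distrib, Finset.sum_neg_distrib, ← mul_assoc]
  rw [two_smul]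
  abel

theorem norm_conj_of_norm_one (p : Hq) {x : Hq} (hx : ‖x‖ = 1) : ‖p * x * star p‖ = ‖p‖ ^ 2 := by
  rw [norm_mul, norm_mul, hx, Quaternion.norm_star, mul_one, sq]

@[simp] theorem re_qi : qi.re = 0 := rfl

@[simp] theorem imI_qi : qi.imI = 1 := rfl

@[simp] theorem imJ_qi : qi.imJ = 0 := rfl

@[simp] theorem imK_qi : qi.imK = 0 := rfl

theorem star_qi : star qi = -qi := by
  ext <;> simp

theorem star_qi_mul_qi : star qi * qi = 1 := by
  rw [Quaternion.star_mul_self, Quaternion.normSq_def']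
  simp

theorem norm_qi : ‖qi‖ = 1 := by
  have h : ‖qi‖ * ‖qi‖ = 1 := by
    rw [← Quaternion.normSq_eq_norm_mul_self, Quaternion.normSq_def']
    simp
  nlinarith [norm_nonneg qi]

/-- for `1 ≤ m ≤ n` and every `g ∈ Sp(n,1)`, the set of traces of
`g·(I_{n−m} ⊕ Sp(m,1))·g⁻¹` is not contained in `ℝ`. -/
theorem stmt10 (n m : ℕ) (hm : 1 ≤ m) (hmn : m ≤ n)
    (g : Matrix (Fin (n+1)) (Fin (n+1)) Hq) (hg : g ∈ Sp n) :
    ∃ A ∈ Sp m,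
      ¬ isRealQ ((g * castM (by omega : (n - m) + (m + 1) = n + 1)
          (oplus (1 : Matrix (Fin (n - m)) (Fin (n - m)) Hq) A) * Ring.inverse g).trace) := by
  refine ⟨_, diagonal_last_mem_Sp star_qi_mul_qi, fun hreal => ?_⟩
  rw [castM_oplus_diagonal_last, inverse_eq_of_mem_Sp hg] at hreal
  have h := trace_sub_star_trace g star_qi
  simp only [star_eq_self_of_isRealQ hreal, sub_self] at h
  have h0 := sub_eq_zero.mp ((smul_eq_zero.mp h.symm).resolve_left two_ne_zero)
  have hle : ‖g (Fin.last n) (Fin.last n)‖ ^ 2 ≤ ∑ a : Fin n, ‖g a.castSucc (Fin.last n)‖ ^ 2 := by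
    rw [← norm_conj_of_norm_one _ norm_qi, h0]
    exact (norm_sum_le _ _).trans_eq
      (Finset.sum_congr rfl fun a _ => norm_conj_of_norm_one _ norm_qi)
  linarith [norm_sq_last_of_mem_Sp hg]
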